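/- arXiv:1507.00845 — 2 statements merged into one kernel-verified Lean document; each statement's English description precedes it below -/
import Mathlib

section
/- For every real α with 0 < α < 1 there exist constants C > 0 and η₀ ≥ 1 such that for all real η ≥ η₀ one has |E_{α,1}(-η) − 1/(Γ(1−α)·η)| ≤ C/η². In other words, E_{α,1}(-η) = 1/(Γ(1−α)η) + O(1/η²) as η → ∞. -/
/-- The Mittag-Leffler function `E_{α,β}(x) = ∑_{k=0}^∞ x^k / Γ(αk + β)` for real `x`,
where `1/Γ` is interpreted as its entire extension (Mathlib's `Real.Gamma` vanishes at the
poles, so division yields `0` there). The series converges absolutely for every `x`. -/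
noncomputable def mittagLeffler (α β x : ℝ) : ℝ :=
  ∑' k : ℕ, x ^ k / Real.Gamma (α * k + β)

open MeasureTheory Set Filter Topology Complex
open scoped Real

/-- The closed horizontal strip `|Im w| ≤ π`, the logarithm of the plane cut along the
negative real axis. -/
def hankelStrip : Set ℂ := {w | |w.im| ≤ π}

/-- The integral of `f` along the contour `+∞ - πi → a - πi → a + πi → +∞ + πi`, the logarithm of
a Hankel contour with radius `exp a`. -/
noncomputable def hankelIntegral (a : ℝ) (f : ℂ → ℂ) : ℂ :=
  (∫ x in Ioi a, f (x + (π : ℝ) * I)) - (∫ x in Ioi a, f (x + (-π : ℝ) * I))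
    + I * ∫ y in (-π)..π, f (a + y * I)

/-- The function `exp z * z ^ c` in the coordinate `w = log z`. -/
noncomputable def hankelKernel (c : ℝ) (w : ℂ) : ℂ := cexp (cexp w) * cexp (c * w)

/-- The function `f` is continuous on the strip and bounded by `M` times the kernel
`hankelKernel c` to the right of the line `Re w = a`. -/
structure HankelDominated (a c M : ℝ) (f : ℂ → ℂ) : Prop where
  continuousOn : ContinuousOn f hankelStrip
  norm_le : ∀ w ∈ hankelStrip, a ≤ w.re → ‖f w‖ ≤ M * ‖hankelKernel c w‖

theorem differentiable_hankelKernel (c : ℝ) : Differentiable ℂ (hankelKernel c) := by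
  unfold hankelKernel
  fun_prop

theorem hankelDominated_hankelKernel (a c : ℝ) :
    HankelDominated a c 1 (hankelKernel c) where
  continuousOn := (differentiable_hankelKernel c).continuous.continuousOn
  norm_le w _ _ := by rw [one_mul]

theorem norm_hankelKernel (c x y : ℝ) :
    ‖hankelKernel c (x + y * I)‖ = Real.exp (Real.exp x * Real.cos y) * Real.exp (c * x) := by
  rw [hankelKernel, norm_mul, norm_exp, norm_exp, exp_re]
  simp

theorem exp_neg_exp_mul_exp_le (c x : ℝ) (hx : 0 ≤ x) :
    Real.exp (-Real.exp x) * Real.exp (c * x) ≤ Real.exp ((c + 1) ^ 2 / 2) * Real.exp (-1 * x) := by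
  rw [← Real.exp_add, ← Real.exp_add, Real.exp_le_exp]
  have := Real.quadratic_le_exp_of_nonneg hx
  nlinarith [sq_nonneg (c + 1 - x)]

theorem integrableOn_exp_neg_exp_mul_exp (a c : ℝ) :
    IntegrableOn (fun x : ℝ => Real.exp (-Real.exp x) * Real.exp (c * x)) (Ioi a) := by
  refine integrable_of_isBigO_exp_neg one_pos (by fun_prop) ?_
  refine Asymptotics.IsBigO.of_bound (Real.exp ((c + 1) ^ 2 / 2)) ?_
  filter_upwards [eventually_ge_atTop 0] with x hx
  rw [Real.norm_of_nonneg (by positivity), Real.norm_of_nonneg (by positivity)]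
  exact exp_neg_exp_mul_exp_le c x hx

theorem tendsto_exp_neg_exp_mul_exp_atTop (c : ℝ) :
    Tendsto (fun x : ℝ => Real.exp (-Real.exp x) * Real.exp (c * x)) atTop (𝓝 0) := by
  have h : Tendsto (fun x : ℝ => Real.exp ((c + 1) ^ 2 / 2) * Real.exp (-1 * x)) atTop (𝓝 0) := by
    simpa using (Real.tendsto_exp_neg_atTop_nhds_zero).const_mul (Real.exp ((c + 1) ^ 2 / 2))
  refine squeeze_zero' (Eventually.of_forall fun x => by positivity) ?_ h
  filter_upwards [eventually_ge_atTop 0] with x hx using exp_neg_exp_mul_exp_le c x hx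

theorem mem_hankelStrip {x y : ℝ} (hy : |y| ≤ π) : (x + y * I : ℂ) ∈ hankelStrip := by
  simpa [hankelStrip] using hy

/-- The bound for `‖hankelIntegral a f‖` when `f` is bounded by `hankelKernel c`. -/
noncomputable def hankelBound (a c : ℝ) : ℝ :=
  2 * (∫ x in Ioi a, Real.exp (-Real.exp x) * Real.exp (c * x))
    + Real.exp (Real.exp a) * Real.exp (c * a) * (2 * π)

theorem hankelBound_nonneg (a c : ℝ) : 0 ≤ hankelBound a c := by
  have : 0 ≤ ∫ x in Ioi a, Real.exp (-Real.exp x) * Real.exp (c * x) :=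
    integral_nonneg fun x => by positivity
  unfold hankelBound
  positivity

namespace HankelDominated

variable {a b c M : ℝ} {f g : ℂ → ℂ}

theorem continuous_horizontal (hf : HankelDominated a c M f) {y : ℝ} (hy : |y| ≤ π) :
    Continuous fun x : ℝ => f (x + y * I) :=
  hf.continuousOn.comp_continuous (by fun_prop) fun _ => mem_hankelStrip hy

theorem integrableOn (hf : HankelDominated a c M f) {y : ℝ} (hy : |y| = π) :
    IntegrableOn (fun x : ℝ => f (x + y * I)) (Ioi a) := by
  refine Integrable.mono' ((integrableOn_exp_neg_exp_mul_exp a c).const_mul M)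
    (hf.continuous_horizontal hy.le).aestronglyMeasurable ?_
  filter_upwards [ae_restrict_mem measurableSet_Ioi] with x hx
  have := hf.norm_le (x + y * I) (mem_hankelStrip hy.le) (by simpa using (mem_Ioi.1 hx).le)
  rwa [norm_hankelKernel, ← Real.cos_abs y, hy, Real.cos_pi, mul_neg_one] at this

theorem intervalIntegrable (hf : HankelDominated a c M f) (b : ℝ) :
    IntervalIntegrable (fun y : ℝ => f (b + y * I)) volume (-π) π := by
  refine ContinuousOn.intervalIntegrable ?_
  refine hf.continuousOn.comp (by fun_prop) fun y hy => mem_hankelStrip ?_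
  rw [uIcc_of_le (by linarith [Real.pi_pos])] at hy
  exact abs_le.2 hy

theorem hankelIntegral_add {c' M' : ℝ} (hf : HankelDominated a c M f)
    (hg : HankelDominated a c' M' g) :
    hankelIntegral a (fun w => f w + g w) = hankelIntegral a f + hankelIntegral a g := by
  have hp : |π| = π := abs_of_pos Real.pi_pos
  have hn : |-π| = π := by rw [abs_neg, hp]
  unfold hankelIntegral
  rw [integral_add (hf.integrableOn hp) (hg.integrableOn hp),
    integral_add (hf.integrableOn hn) (hg.integrableOn hn),
    intervalIntegral.integral_add (hf.intervalIntegrable a) (hg.intervalIntegrable a)]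
  ring

theorem norm_hankelIntegral_le (hM : 0 ≤ M) (hf : HankelDominated a c M f) :
    ‖hankelIntegral a f‖ ≤ M * hankelBound a c := by
  have hp : |π| = π := abs_of_pos Real.pi_pos
  have hn : |-π| = π := by rw [abs_neg, hp]
  have hor : ∀ y : ℝ, |y| = π → ‖∫ x in Ioi a, f (x + y * I)‖
      ≤ M * ∫ x in Ioi a, Real.exp (-Real.exp x) * Real.exp (c * x) := by
    intro y hy
    rw [← integral_const_mul]
    refine norm_integral_le_of_norm_le ((integrableOn_exp_neg_exp_mul_exp a c).const_mul M) ?_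
    filter_upwards [ae_restrict_mem measurableSet_Ioi] with x hx
    have := hf.norm_le (x + y * I) (mem_hankelStrip hy.le) (by simpa using (mem_Ioi.1 hx).le)
    rwa [norm_hankelKernel, ← Real.cos_abs y, hy, Real.cos_pi, mul_neg_one] at this
  have ver : ‖I * ∫ y in (-π)..π, f (a + y * I)‖
      ≤ M * (Real.exp (Real.exp a) * Real.exp (c * a)) * (2 * π) := by
    rw [norm_mul, norm_I, one_mul]
    have hpi : |π - -π| = 2 * π := by
      rw [abs_of_pos (by linarith [Real.pi_pos])]; ring
    rw [← hpi]
    refine intervalIntegral.norm_integral_le_of_norm_le_const fun y hy => ?_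
    rw [uIoc_of_le (by linarith [Real.pi_pos])] at hy
    refine (hf.norm_le _ (mem_hankelStrip (abs_le.2 ⟨hy.1.le, hy.2⟩)) (by simp)).trans ?_
    rw [norm_hankelKernel]
    gcongr
    exact mul_le_of_le_one_right (Real.exp_pos a).le (Real.cos_le_one y)
  calc ‖hankelIntegral a f‖ ≤ _ := (norm_add_le _ _).trans (add_le_add (norm_sub_le _ _) le_rfl)
    _ ≤ _ := add_le_add (add_le_add (hor _ hp) (hor _ hn)) ver
    _ = M * hankelBound a c := by unfold hankelBound; ring

/-- The Hankel integral of a holomorphic function does not depend on the radius. -/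
theorem hankelIntegral_eq (hf : HankelDominated a c M f) (hd : DifferentiableOn ℂ f hankelStrip)
    (hab : a ≤ b) : hankelIntegral a f = hankelIntegral b f := by
  have hp : |π| = π := abs_of_pos Real.pi_pos
  have hn : |-π| = π := by rw [abs_neg, hp]
  have hor : ∀ y : ℝ, |y| = π → (∫ x in a..b, f (x + y * I)) + ∫ x in Ioi b, f (x + y * I)
      = ∫ x in Ioi a, f (x + y * I) := fun y hy =>
    intervalIntegral.integral_interval_add_Ioi (hf.integrableOn hy)
      ((hf.integrableOn hy).mono_set (Ioi_subset_Ioi hab))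
  have rect := integral_boundary_rect_eq_zero_of_differentiableOn f
    (a + (-π : ℝ) * I) (b + (π : ℝ) * I) (hd.mono fun w hw => by
      have h2 := hw.2
      simp only [add_im, ofReal_im, mul_im, ofReal_re, I_im, I_re, mul_one, mul_zero, zero_add,
        add_zero, mem_preimage, uIcc_of_le (show -π ≤ π by linarith [Real.pi_pos])] at h2
      exact abs_le.2 h2)
  simp only [add_im, ofReal_im, mul_im, ofReal_re, I_im, I_re, mul_one, mul_zero, zero_add,
    add_zero, add_re, mul_re, sub_zero, smul_eq_mul] at rect
  unfold hankelIntegral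
  rw [← hor _ hp, ← hor _ hn]
  linear_combination -rect

/-- The Hankel integral of a derivative vanishes. -/
theorem hankelIntegral_deriv {c' M' : ℝ} (hf : HankelDominated a c M f)
    (hg : HankelDominated a c' M' g) (h : ∀ w, HasDerivAt f (g w) w) :
    hankelIntegral a g = 0 := by
  have hp : |π| = π := abs_of_pos Real.pi_pos
  have hn : |-π| = π := by rw [abs_neg, hp]
  have hor : ∀ y : ℝ, |y| = π → ∫ x in Ioi a, g (x + y * I) = 0 - f (a + y * I) := by
    intro y hy
    have hder : ∀ x : ℝ, HasDerivAt (fun x : ℝ => f (x + y * I)) (g (x + y * I)) x := by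
      intro x
      have h1 : HasDerivAt (fun z : ℂ => f (z + y * I)) (g (x + y * I)) (x : ℂ) := by
        simpa using (h (x + y * I)).comp_add_const (x : ℂ) (y * I)
      exact h1.comp_ofReal
    refine integral_Ioi_of_hasDerivAt_of_tendsto (hder a).continuousAt.continuousWithinAt
      (fun x _ => hder x) (hg.integrableOn hy) ?_
    have h0 : Tendsto (fun x : ℝ => M * (Real.exp (-Real.exp x) * Real.exp (c * x))) atTop
        (𝓝 0) := by simpa using (tendsto_exp_neg_exp_mul_exp_atTop c).const_mul M
    refine squeeze_zero_norm' ?_ h0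
    filter_upwards [eventually_ge_atTop a] with x hx
    have := hf.norm_le (x + y * I) (mem_hankelStrip hy.le) (by simpa using hx)
    rwa [norm_hankelKernel, ← Real.cos_abs y, hy, Real.cos_pi, mul_neg_one] at this
  have ver : ∫ y in (-π)..π, I * g (a + y * I) = f (a + (π : ℝ) * I) - f (a + (-π : ℝ) * I) := by
    refine intervalIntegral.integral_eq_sub_of_hasDerivAt (f := fun y : ℝ => f (a + y * I))
      (fun y _ => ?_) ((hg.intervalIntegrable a).const_mul I)
    have h1 : HasDerivAt (fun z : ℂ => (a + z * I : ℂ)) I (y : ℂ) := by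
      simpa using ((hasDerivAt_id (y : ℂ)).mul_const I).const_add (a : ℂ)
    have h2 := (h (a + y * I)).comp (y : ℂ) h1
    rw [mul_comm] at h2
    exact h2.comp_ofReal
  rw [intervalIntegral.integral_const_mul] at ver
  unfold hankelIntegral
  rw [hor _ hp, hor _ hn, ver]
  ring

end HankelDominated

theorem hankelIntegral_congr (a : ℝ) {f g : ℂ → ℂ} (h : EqOn f g hankelStrip) :
    hankelIntegral a f = hankelIntegral a g := by
  have hp : |π| ≤ π := (abs_of_pos Real.pi_pos).le
  have hn : |-π| ≤ π := by rwa [abs_neg]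
  have hver : ∫ y in (-π)..π, f (a + y * I) = ∫ y in (-π)..π, g (a + y * I) := by
    refine intervalIntegral.integral_congr fun y hy => h (mem_hankelStrip ?_)
    rw [uIcc_of_le (by linarith [Real.pi_pos])] at hy
    exact abs_le.2 hy
  simp only [hankelIntegral, h (mem_hankelStrip hp), h (mem_hankelStrip hn), hver]

theorem hankelIntegral_const_mul (a : ℝ) (r : ℂ) (f : ℂ → ℂ) :
    hankelIntegral a (fun w => r * f w) = r * hankelIntegral a f := by
  unfold hankelIntegral
  rw [integral_const_mul, integral_const_mul, intervalIntegral.integral_const_mul]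
  ring

theorem hankelIntegral_hankelKernel_eq (a b c : ℝ) :
    hankelIntegral a (hankelKernel c) = hankelIntegral b (hankelKernel c) := by
  rcases le_total a b with h | h
  · exact (hankelDominated_hankelKernel a c).hankelIntegral_eq
      (differentiable_hankelKernel c).differentiableOn h
  · exact ((hankelDominated_hankelKernel b c).hankelIntegral_eq
      (differentiable_hankelKernel c).differentiableOn h).symm

theorem HankelDominated.const_mul {a c M : ℝ} {f : ℂ → ℂ} (hf : HankelDominated a c M f) (r : ℂ) :
    HankelDominated a c (‖r‖ * M) fun w => r * f w where
  continuousOn := continuousOn_const.mul hf.continuousOn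
  norm_le w hw ha := by
    rw [norm_mul, mul_assoc]
    exact mul_le_mul_of_nonneg_left (hf.norm_le w hw ha) (norm_nonneg r)

theorem hankelKernel_add (c d : ℝ) (w : ℂ) :
    hankelKernel (c + d) w = hankelKernel c w * cexp (d * w) := by
  rw [hankelKernel, hankelKernel, mul_assoc, ofReal_add, add_mul, Complex.exp_add]

/-- The contour integral form of the functional equation of `1 / Γ`. -/
theorem hankelIntegral_hankelKernel_add_one (a c : ℝ) :
    hankelIntegral a (hankelKernel (c + 1)) = -c * hankelIntegral a (hankelKernel c) := by
  have h1 := hankelDominated_hankelKernel a (c + 1)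
  have h2 := hankelDominated_hankelKernel a c
  have hd : ∀ w, HasDerivAt (hankelKernel c) (hankelKernel (c + 1) w + c * hankelKernel c w) w := by
    intro w
    have e1 := ((hasDerivAt_id w).cexp).cexp
    have e2 := ((hasDerivAt_id w).const_mul (c : ℂ)).cexp
    refine (e1.mul e2).congr_deriv ?_
    rw [hankelKernel_add, hankelKernel]
    simp only [id, ofReal_one, one_mul]
    ring
  obtain ⟨c', M', hdom⟩ : ∃ c' M', HankelDominated a c' M' fun w =>
      hankelKernel (c + 1) w + c * hankelKernel c w := by
    refine ⟨c + 1, 1 + |c| * Real.exp (-a), ?_, fun w hw ha => ?_⟩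
    · exact h1.continuousOn.add (continuousOn_const.mul h2.continuousOn)
    · have hk : ‖hankelKernel c w‖ ≤ Real.exp (-a) * ‖hankelKernel (c + 1) w‖ := by
        rw [hankelKernel_add, norm_mul, norm_exp]
        have : 1 ≤ Real.exp (-a) * Real.exp (((1 : ℝ) : ℂ) * w).re := by
          rw [← Real.exp_add]
          exact Real.one_le_exp (by simp; linarith)
        nlinarith [norm_nonneg (hankelKernel c w)]
      refine (norm_add_le _ _).trans ?_
      rw [norm_mul, norm_real, Real.norm_eq_abs]
      nlinarith [mul_le_mul_of_nonneg_left hk (abs_nonneg c)]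
  have h0 := h2.hankelIntegral_deriv hdom hd
  rw [h1.hankelIntegral_add (h2.const_mul (c : ℂ)), hankelIntegral_const_mul] at h0
  linear_combination h0

theorem integral_hankelKernel_horizontal (a c y : ℝ) (hy : |y| = π) :
    ∫ x in Ioi a, hankelKernel c (x + y * I)
      = cexp (c * y * I) * (∫ x in Ioi a, Real.exp (-Real.exp x) * Real.exp (c * x) : ℝ) := by
  have hc : cexp (y * I) = -1 := by
    rcases abs_eq Real.pi_pos.le |>.1 hy with rfl | rfl
    · exact exp_pi_mul_I
    · rw [ofReal_neg, neg_mul, Complex.exp_neg, exp_pi_mul_I]; norm_num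
  rw [← integral_complex_ofReal, ← integral_const_mul]
  refine integral_congr_ae (Eventually.of_forall fun x => ?_)
  simp only [hankelKernel]
  rw [Complex.exp_add, hc, mul_add, Complex.exp_add]
  push_cast
  ring_nf

theorem hankelIntegral_hankelKernel (a c : ℝ) :
    hankelIntegral a (hankelKernel c) = 2 * Real.sin (π * c) * I
      * (∫ x in Ioi a, Real.exp (-Real.exp x) * Real.exp (c * x) : ℝ)
      + I * ∫ y in (-π)..π, hankelKernel c (a + y * I) := by
  have hp : |π| = π := abs_of_pos Real.pi_pos
  have hn : |-π| = π := by rw [abs_neg, hp]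
  rw [hankelIntegral, integral_hankelKernel_horizontal a c π hp,
    integral_hankelKernel_horizontal a c (-π) hn, ← sub_mul]
  congr 2
  rw [Complex.exp_mul_I, ← ofReal_mul, ← ofReal_mul, Complex.exp_mul_I]
  simp only [← ofReal_cos, ← ofReal_sin, mul_neg, Real.cos_neg, Real.sin_neg, mul_comm c π]
  push_cast
  ring

theorem tendsto_vertical_hankelKernel {c : ℝ} (hc : 0 < c) :
    Tendsto (fun a : ℝ => ∫ y in (-π)..π, hankelKernel c (a + y * I)) atBot (𝓝 0) := by
  have h0 : Tendsto (fun a : ℝ => Real.exp (Real.exp a) * Real.exp (c * a) * |π - -π|) atBot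
      (𝓝 0) := by
    have h1 := (Real.continuous_exp.tendsto 0).comp Real.tendsto_exp_atBot
    have h2 := Real.tendsto_exp_atBot.comp (tendsto_id.const_mul_atBot hc)
    simpa using (h1.mul h2).mul_const |π - -π|
  refine squeeze_zero_norm (fun a => ?_) h0
  refine intervalIntegral.norm_integral_le_of_norm_le_const fun y _ => ?_
  rw [norm_hankelKernel]
  gcongr
  exact mul_le_of_le_one_right (Real.exp_pos a).le (Real.cos_le_one y)

theorem tendsto_vertical_hankelKernel_zero :
    Tendsto (fun a : ℝ => ∫ y in (-π)..π, hankelKernel 0 (a + y * I)) atBot (𝓝 (2 * π)) := by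
  have h0 : Tendsto (fun a : ℝ => 2 * Real.exp a * |π - -π|) atBot (𝓝 0) := by
    simpa using (Real.tendsto_exp_atBot.const_mul 2).mul_const |π - -π|
  rw [tendsto_iff_norm_sub_tendsto_zero]
  refine squeeze_zero' (Eventually.of_forall fun _ => norm_nonneg _) ?_ h0
  filter_upwards [eventually_le_atBot 0] with a ha
  have hi := (hankelDominated_hankelKernel a 0).intervalIntegrable a
  have hconst : (2 * π : ℂ) = ∫ _ in (-π)..π, (1 : ℂ) := by
    simp; ring
  rw [hconst, ← intervalIntegral.integral_sub hi intervalIntegrable_const]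
  refine intervalIntegral.norm_integral_le_of_norm_le_const fun y _ => ?_
  have hn : ‖cexp (a + y * I)‖ = Real.exp a := by rw [norm_exp]; simp
  have := norm_exp_sub_one_le (x := cexp (a + y * I)) (by rw [hn]; exact Real.exp_le_one_iff.2 ha)
  rw [hn] at this
  simpa [hankelKernel] using this

theorem integrable_exp_neg_exp_mul_exp {c : ℝ} (hc : 0 < c) :
    Integrable fun x : ℝ => Real.exp (-Real.exp x) * Real.exp (c * x) := by
  have h := Real.GammaIntegral_convergent hc
  rw [← Real.range_exp, ← image_univ, integrableOn_image_iff_integrableOn_abs_deriv_smul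
    MeasurableSet.univ (fun x _ => (Real.hasDerivAt_exp x).hasDerivWithinAt)
    Real.exp_injective.injOn, integrableOn_univ] at h
  refine h.congr (Eventually.of_forall fun x => ?_)
  simp only [smul_eq_mul, abs_of_pos (Real.exp_pos x), ← Real.exp_mul]
  rw [mul_left_comm, ← Real.exp_add]
  congr 2
  ring

theorem integral_exp_neg_exp_mul_exp {c : ℝ} (hc : 0 < c) :
    ∫ x : ℝ, Real.exp (-Real.exp x) * Real.exp (c * x) = Real.Gamma c := by
  rw [Real.Gamma_eq_integral hc, ← Real.range_exp, ← image_univ,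
    integral_image_eq_integral_abs_deriv_smul MeasurableSet.univ
    (fun x _ => (Real.hasDerivAt_exp x).hasDerivWithinAt) Real.exp_injective.injOn,
    setIntegral_univ]
  refine integral_congr_ae (Eventually.of_forall fun x => ?_)
  simp only [smul_eq_mul, abs_of_pos (Real.exp_pos x), ← Real.exp_mul]
  rw [eq_comm, mul_left_comm, ← Real.exp_add]
  congr 2
  ring

theorem hankelIntegral_hankelKernel_of_pos {c : ℝ} (hc : 0 < c) (a : ℝ) :
    hankelIntegral a (hankelKernel c) = 2 * π * I * (Real.Gamma (1 - c))⁻¹ := by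
  have hlim : Tendsto (fun b : ℝ => hankelIntegral b (hankelKernel c)) atBot
      (𝓝 (2 * Real.sin (π * c) * I * (Real.Gamma c : ℝ) + I * 0)) := by
    simp_rw [hankelIntegral_hankelKernel]
    refine Tendsto.add (Tendsto.const_mul _ ?_)
      ((tendsto_vertical_hankelKernel hc).const_mul I)
    rw [← integral_exp_neg_exp_mul_exp hc]
    exact (continuous_ofReal.tendsto _).comp
      ((aecover_Ioi tendsto_id).integral_tendsto_of_countably_generated
        (integrable_exp_neg_exp_mul_exp hc))
  simp_rw [fun b => hankelIntegral_hankelKernel_eq b a c] at hlim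
  rw [tendsto_nhds_unique tendsto_const_nhds hlim]
  have hreal : Real.sin (π * c) * Real.Gamma c = π * (Real.Gamma (1 - c))⁻¹ := by
    have hG := (Real.Gamma_pos_of_pos hc).ne'
    have hr := Real.Gamma_mul_Gamma_one_sub c
    by_cases hs : Real.sin (π * c) = 0
    · rw [hs, div_zero, mul_eq_zero, or_iff_right hG] at hr
      simp [hs, hr]
    · have h1 : Real.Gamma (1 - c) ≠ 0 := fun h => by
        rw [h, mul_zero] at hr
        exact div_ne_zero Real.pi_ne_zero hs hr.symm
      rw [eq_div_iff hs] at hr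
      rw [← div_eq_mul_inv, eq_div_iff h1]
      linear_combination hr
  have := congrArg (fun x : ℝ => (x : ℂ)) hreal
  push_cast at this ⊢
  linear_combination 2 * I * this

/-- Hankel's integral representation of the reciprocal Gamma function. -/
theorem hankelIntegral_hankelKernel_eq_inv_Gamma (a c : ℝ) :
    hankelIntegral a (hankelKernel c) = 2 * π * I * (Real.Gamma (1 - c))⁻¹ := by
  obtain ⟨n, hn⟩ := exists_nat_gt (-c)
  induction n generalizing c with
  | zero => exact hankelIntegral_hankelKernel_of_pos (by simpa using hn) a
  | succ n ih =>
    rcases lt_trichotomy c 0 with hc | rfl | hc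
    · have h1 := ih (c + 1) (by push_cast at hn; linarith)
      rw [hankelIntegral_hankelKernel_add_one] at h1
      have hG := Real.Gamma_add_one (s := -c) (by linarith)
      have hG0 := (Real.Gamma_pos_of_pos (s := -c) (by linarith)).ne'
      rw [show 1 - (c + 1) = -c by ring] at h1
      rw [show 1 - c = -c + 1 by ring, hG]
      have hc' : (c : ℂ) ≠ 0 := by exact_mod_cast hc.ne
      refine mul_left_cancel₀ (neg_ne_zero.2 hc') (h1.trans ?_)
      have hG0' : (Real.Gamma (-c) : ℂ) ≠ 0 := by exact_mod_cast hG0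
      push_cast
      field_simp
    · have hlim := tendsto_vertical_hankelKernel_zero.const_mul I
      have heq : ∀ b : ℝ, I * ∫ y in (-π)..π, hankelKernel 0 (b + y * I)
          = hankelIntegral a (hankelKernel 0) := fun b => by
        rw [hankelIntegral_hankelKernel_eq a b, hankelIntegral_hankelKernel]; simp
      simp_rw [heq] at hlim
      rw [tendsto_nhds_unique tendsto_const_nhds hlim]
      simp
      ring
    · exact hankelIntegral_hankelKernel_of_pos hc a

section MittagLeffler

variable {α η : ℝ}

theorem sin_mul_le_norm_exp_add (hα0 : 0 < α) (hα1 : α < 1) {w : ℂ} (hw : w ∈ hankelStrip) :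
    η * Real.sin (π * α) ≤ ‖cexp (α * w) + η‖ := by
  have hw' : |w.im| ≤ π := hw
  have hpa : π * α ≤ π := by nlinarith [Real.pi_pos]
  have hcos : Real.cos (π * α) ≤ Real.cos (α * w.im) := by
    rw [← Real.cos_abs (α * w.im), abs_mul, abs_of_pos hα0]
    exact Real.cos_le_cos_of_nonneg_of_le_pi (by positivity) hpa (by nlinarith)
  rcases le_or_gt η 0 with hη | hη
  · have : 0 ≤ Real.sin (π * α) := Real.sin_nonneg_of_nonneg_of_le_pi (by positivity) hpa
    exact (mul_nonpos_of_nonpos_of_nonneg hη this).trans (norm_nonneg _)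
  refine le_of_sq_le_sq ?_ (norm_nonneg _)
  rw [← normSq_eq_norm_sq, normSq_apply]
  simp only [add_re, add_im, exp_re, exp_im, mul_re, mul_im, ofReal_re, ofReal_im, zero_mul,
    sub_zero, add_zero]
  have hr := Real.exp_pos (α * w.re)
  set r := Real.exp (α * w.re)
  have h1 := mul_le_mul_of_nonneg_left hcos (mul_pos hr hη).le
  have h2 := Real.sin_sq_add_cos_sq (α * w.im)
  have h3 := Real.sin_sq_add_cos_sq (π * α)
  calc (η * Real.sin (π * α)) ^ 2
      ≤ (η * Real.sin (π * α)) ^ 2 + (r + η * Real.cos (π * α)) ^ 2 :=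
        le_add_of_nonneg_right (sq_nonneg _)
    _ = r ^ 2 + 2 * (r * η * Real.cos (π * α)) + η ^ 2 := by linear_combination η ^ 2 * h3
    _ ≤ r ^ 2 + 2 * (r * η * Real.cos (α * w.im)) + η ^ 2 := by linarith
    _ = _ := by linear_combination -r ^ 2 * h2

theorem exp_add_ne_zero (hα0 : 0 < α) (hα1 : α < 1) (hη : 0 < η) {w : ℂ} (hw : w ∈ hankelStrip) :
    cexp (α * w) + η ≠ 0 := by
  have hs : 0 < Real.sin (π * α) :=
    Real.sin_pos_of_pos_of_lt_pi (by positivity) (by nlinarith [Real.pi_pos])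
  exact norm_pos_iff.1 ((mul_pos hη hs).trans_le (sin_mul_le_norm_exp_add hα0 hα1 hw))

theorem differentiableOn_hankelKernel_div (hα0 : 0 < α) (hα1 : α < 1) (hη : 0 < η) (c : ℝ) :
    DifferentiableOn ℂ (fun w => hankelKernel c w / (cexp (α * w) + η)) hankelStrip :=
  (differentiable_hankelKernel c).differentiableOn.div (by fun_prop)
    fun _ hw => exp_add_ne_zero hα0 hα1 hη hw

theorem hankelDominated_hankelKernel_div (hα0 : 0 < α) (hα1 : α < 1) (hη : 0 < η) (a c : ℝ) :
    HankelDominated a c (η * Real.sin (π * α))⁻¹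
      fun w => hankelKernel c w / (cexp (α * w) + η) where
  continuousOn := (differentiableOn_hankelKernel_div hα0 hα1 hη c).continuousOn
  norm_le w hw _ := by
    have hs : 0 < Real.sin (π * α) :=
      Real.sin_pos_of_pos_of_lt_pi (by positivity) (by nlinarith [Real.pi_pos])
    rw [norm_div, div_eq_inv_mul]
    gcongr
    exact sin_mul_le_norm_exp_add hα0 hα1 hw

theorem hankelDominated_pow_mul (hα0 : 0 < α) (hα1 : α < 1) (hη : 0 < η) {a : ℝ}
    (ha : 2 * η ≤ Real.exp (α * a)) (n : ℕ) :
    HankelDominated a α ((1 / 2) ^ n * (η * Real.sin (π * α))⁻¹) fun w =>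
      (-η * cexp (-(α * w))) ^ n * (hankelKernel α w / (cexp (α * w) + η)) where
  continuousOn := ContinuousOn.mul (by fun_prop)
    (hankelDominated_hankelKernel_div hα0 hα1 hη a α).continuousOn
  norm_le w hw haw := by
    rw [norm_mul, norm_pow, mul_assoc]
    refine mul_le_mul (pow_le_pow_left₀ (norm_nonneg _) ?_ n)
      ((hankelDominated_hankelKernel_div hα0 hα1 hη a α).norm_le w hw haw) (norm_nonneg _)
      (by positivity)
    have h1 : Real.exp (α * a) ≤ Real.exp (α * w.re) := by gcongr
    rw [norm_mul, norm_neg, norm_real, Real.norm_of_nonneg hη.le, norm_exp]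
    simp only [neg_re, mul_re, ofReal_re, ofReal_im, zero_mul, sub_zero, Real.exp_neg]
    rw [← div_eq_mul_inv, div_le_div_iff₀ (Real.exp_pos _) two_pos]
    linarith

theorem hankelIntegral_eq_sum_add (hα0 : 0 < α) (hα1 : α < 1) (hη : 0 < η) {a : ℝ}
    (ha : 2 * η ≤ Real.exp (α * a)) (n : ℕ) :
    hankelIntegral a (fun w => hankelKernel α w / (cexp (α * w) + η))
      = ∑ k ∈ Finset.range n, 2 * π * I * ((-η) ^ k / Real.Gamma (α * k + 1) : ℝ)
        + hankelIntegral a fun w =>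
          (-η * cexp (-(α * w))) ^ n * (hankelKernel α w / (cexp (α * w) + η)) := by
  induction n with
  | zero => simp
  | succ n ih =>
    rw [ih, Finset.sum_range_succ, add_assoc]
    congr 1
    have h1 := (hankelDominated_hankelKernel a (-(α * n))).const_mul ((-η : ℂ) ^ n)
    have h2 := h1.hankelIntegral_add (hankelDominated_pow_mul hα0 hα1 hη ha (n + 1))
    rw [hankelIntegral_const_mul, hankelIntegral_hankelKernel_eq_inv_Gamma] at h2
    have hG : 1 - -(α * n) = α * n + 1 := by ring
    rw [hG] at h2
    trans hankelIntegral a fun w => (-η : ℂ) ^ n * hankelKernel (-(α * n)) w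
      + (-η * cexp (-(α * w))) ^ (n + 1) * (hankelKernel α w / (cexp (α * w) + η))
    · refine hankelIntegral_congr a fun w hw => ?_
      have hne := exp_add_ne_zero hα0 hα1 hη hw
      have hX := Complex.exp_ne_zero (α * w)
      have hk : hankelKernel (-(α * n)) w = cexp (cexp w) * cexp (-(α * w)) ^ n := by
        rw [hankelKernel, ← Complex.exp_nat_mul]
        push_cast
        ring_nf
      simp only [hk]
      simp only [hankelKernel, mul_pow, pow_succ, Complex.exp_neg]
      field_simp
      ring
    · rw [h2]
      push_cast
      ring

theorem summable_mittagLeffler (hα0 : 0 < α) (hη : 0 < η) {a : ℝ}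
    (ha : 2 * η ≤ Real.exp (α * a)) :
    Summable fun k : ℕ => (-η) ^ k / Real.Gamma (α * k + 1) := by
  refine Summable.of_norm_bounded
    (g := fun k : ℕ => hankelBound a 0 / (2 * π) * (1 / 2 : ℝ) ^ k)
    (summable_geometric_two.mul_left _) fun k => ?_
  have hdom : HankelDominated a 0 (Real.exp (α * a) ^ k)⁻¹ (hankelKernel (-(α * k))) :=
    { continuousOn := (differentiable_hankelKernel _).continuous.continuousOn
      norm_le := fun w _ haw => by
        rw [← zero_add (-(α * k)), hankelKernel_add, norm_mul, mul_comm]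
        refine mul_le_mul_of_nonneg_right ?_ (norm_nonneg _)
        rw [norm_exp, ← Real.exp_nat_mul, ← Real.exp_neg, Real.exp_le_exp, re_ofReal_mul]
        have : 0 ≤ α * k := by positivity
        nlinarith }
  have hle := hdom.norm_hankelIntegral_le (by positivity)
  rw [hankelIntegral_hankelKernel_eq_inv_Gamma, show 1 - -(α * k) = α * k + 1 by ring, norm_mul,
    norm_mul, norm_mul, norm_I, norm_real, norm_real, norm_inv, norm_ofNat, mul_one,
    Real.norm_of_nonneg Real.pi_pos.le] at hle
  have hpow : η ^ k * (Real.exp (α * a) ^ k)⁻¹ ≤ (1 / 2) ^ k := by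
    rw [← inv_pow, ← mul_pow]
    refine pow_le_pow_left₀ (by positivity) ?_ k
    rw [← div_eq_mul_inv, div_le_div_iff₀ (Real.exp_pos _) two_pos]
    linarith
  rw [norm_div, norm_pow, norm_neg, Real.norm_of_nonneg hη.le, div_mul_eq_mul_div,
    le_div_iff₀ (by positivity)]
  calc η ^ k / ‖Real.Gamma (α * k + 1)‖ * (2 * π)
      = η ^ k * (2 * π * ‖Real.Gamma (α * k + 1)‖⁻¹) := by ring
    _ ≤ η ^ k * ((Real.exp (α * a) ^ k)⁻¹ * hankelBound a 0) := by gcongr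
    _ = η ^ k * (Real.exp (α * a) ^ k)⁻¹ * hankelBound a 0 := by ring
    _ ≤ (1 / 2) ^ k * hankelBound a 0 :=
        mul_le_mul_of_nonneg_right hpow (hankelBound_nonneg a 0)
    _ = hankelBound a 0 * (1 / 2) ^ k := mul_comm _ _

/-- The Hankel integral representation of `E_{α,1}(-η)`. -/
theorem two_pi_I_mul_mittagLeffler (hα0 : 0 < α) (hα1 : α < 1) (hη : 0 < η) (b : ℝ) :
    2 * π * I * (mittagLeffler α 1 (-η) : ℝ)
      = hankelIntegral b fun w => hankelKernel α w / (cexp (α * w) + η) := by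
  obtain ⟨a, hba, ha⟩ : ∃ a, b ≤ a ∧ 2 * η ≤ Real.exp (α * a) :=
    ((eventually_ge_atTop b).and ((Real.tendsto_exp_atTop.comp
      (tendsto_id.const_mul_atTop hα0)).eventually_ge_atTop (2 * η))).exists
  rw [(hankelDominated_hankelKernel_div hα0 hα1 hη b α).hankelIntegral_eq
    (differentiableOn_hankelKernel_div hα0 hα1 hη α) hba]
  have hs : 0 < Real.sin (π * α) :=
    Real.sin_pos_of_pos_of_lt_pi (by positivity) (by nlinarith [Real.pi_pos])
  have hsum := (hasSum_ofReal.2 (summable_mittagLeffler hα0 hη ha).hasSum).mul_left (2 * π * I)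
  have hrem : Tendsto (fun n : ℕ => hankelIntegral a fun w =>
      (-η * cexp (-(α * w))) ^ n * (hankelKernel α w / (cexp (α * w) + η))) atTop (𝓝 0) := by
    refine squeeze_zero_norm (fun n =>
      (hankelDominated_pow_mul hα0 hα1 hη ha n).norm_hankelIntegral_le (by positivity)) ?_
    simpa using ((tendsto_pow_atTop_nhds_zero_of_lt_one (r := (1 / 2 : ℝ)) (by norm_num)
      (by norm_num)).mul_const (η * Real.sin (π * α))⁻¹).mul_const (hankelBound a α)
  have hlim := hsum.tendsto_sum_nat.add hrem
  simp_rw [← hankelIntegral_eq_sum_add hα0 hα1 hη ha, add_zero] at hlim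
  exact tendsto_nhds_unique hlim tendsto_const_nhds

theorem norm_mittagLeffler_sub_le (hα0 : 0 < α) (hα1 : α < 1) (hη : 0 < η) :
    |mittagLeffler α 1 (-η) - 1 / (Real.Gamma (1 - α) * η)|
      ≤ hankelBound 0 (2 * α) / (2 * π * Real.sin (π * α)) / η ^ 2 := by
  have hs : 0 < Real.sin (π * α) :=
    Real.sin_pos_of_pos_of_lt_pi (by positivity) (by nlinarith [Real.pi_pos])
  have hη' : (η : ℂ) ≠ 0 := by exact_mod_cast hη.ne'
  have hrem := (hankelDominated_hankelKernel_div hα0 hα1 hη 0 (2 * α)).const_mul (-(η : ℂ)⁻¹)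
  have hadd := ((hankelDominated_hankelKernel 0 α).const_mul (η : ℂ)⁻¹).hankelIntegral_add hrem
  have hcongr : EqOn (fun w => hankelKernel α w / (cexp (α * w) + η))
      (fun w => (η : ℂ)⁻¹ * hankelKernel α w
        + -(η : ℂ)⁻¹ * (hankelKernel (2 * α) w / (cexp (α * w) + η))) hankelStrip := by
    intro w hw
    have hne := exp_add_ne_zero hα0 hα1 hη hw
    simp only [two_mul, hankelKernel_add]
    field_simp
    ring
  rw [← hankelIntegral_congr 0 hcongr, ← two_pi_I_mul_mittagLeffler hα0 hα1 hη,
    hankelIntegral_const_mul, hankelIntegral_hankelKernel_eq_inv_Gamma] at hadd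
  have hle := hrem.norm_hankelIntegral_le (by positivity)
  rw [← sub_eq_iff_eq_add'.2 hadd] at hle
  have heq : 2 * π * I * (mittagLeffler α 1 (-η) : ℝ)
      - (η : ℂ)⁻¹ * (2 * π * I * ((Real.Gamma (1 - α))⁻¹ : ℝ))
      = 2 * π * I * (mittagLeffler α 1 (-η) - 1 / (Real.Gamma (1 - α) * η) : ℝ) := by
    push_cast
    rw [one_div, mul_inv]
    ring
  rw [← ofReal_inv, ofReal_inv η] at hle
  rw [heq, norm_mul, norm_mul, norm_mul, norm_I, norm_real, norm_real, norm_ofNat, mul_one,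
    Real.norm_of_nonneg Real.pi_pos.le, norm_neg, norm_inv, norm_real,
    Real.norm_of_nonneg hη.le, Real.norm_eq_abs, ← le_div_iff₀' (by positivity)] at hle
  refine hle.trans_eq ?_
  field_simp

end MittagLeffler

/-- For `0 < α < 1`, `E_{α,1}(-η) = 1/(Γ(1-α)η) + O(1/η²)` as `η → ∞`: there are constants
`C > 0` and `η₀ ≥ 1` such that `|E_{α,1}(-η) - 1/(Γ(1-α)η)| ≤ C/η²` for all `η ≥ η₀`. -/
theorem mittagLeffler_asymptotic (α : ℝ) (hα0 : 0 < α) (hα1 : α < 1) :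
    ∃ C > (0 : ℝ), ∃ η₀ ≥ (1 : ℝ), ∀ η ≥ η₀,
      |mittagLeffler α 1 (-η) - 1 / (Real.Gamma (1 - α) * η)| ≤ C / η ^ 2 := by
  have hs : 0 < Real.sin (π * α) :=
    Real.sin_pos_of_pos_of_lt_pi (by positivity) (by nlinarith [Real.pi_pos])
  have hB := hankelBound_nonneg 0 (2 * α)
  refine ⟨hankelBound 0 (2 * α) / (2 * π * Real.sin (π * α)) + 1, by positivity, 1, le_rfl,
    fun η hη => ?_⟩
  refine (norm_mittagLeffler_sub_le hα0 hα1 (by linarith)).trans ?_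
  gcongr
  linarith
end

section
/- Let 0 < α < 1, let (λ_n)_{n≥1} be a sequence of positive reals, and let (ψ_n)_{n≥1} be a sequence of reals such that ∑_{n=1}^∞ λ_n^ℓ |ψ_n| < ∞ for every natural number ℓ. Suppose there is a sequence (t_i)_{i≥1} of positive reals with t_i → 0 such that ∑_{n=1}^∞ E_{α,1}(−λ_n t_i^α) ψ_n = 0 for every i. Then all moments vanish: ∑_{n=1}^∞ λ_n^ℓ ψ_n = 0 for every natural number ℓ ≥ 0. -/
open Filter Topology Finset

namespace Ring

theorem multichoose_add {R : Type*} [CommRing R] [BinomialRing R] (r s : R) (n : ℕ) :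
    multichoose (r + s) n = ∑ ij ∈ antidiagonal n, multichoose r ij.1 * multichoose s ij.2 := by
  have key : ∀ (a : R) (m : ℕ), multichoose a m = Int.negOnePow m • choose (-a) m := by
    intro a m
    rw [choose_neg', smul_smul, ← Int.negOnePow_add, Int.negOnePow_even _ ⟨_, rfl⟩, one_smul]
  rw [key, neg_add, add_choose_eq n (Commute.all _ _), smul_sum]
  refine sum_congr rfl fun ij hij => ?_
  rw [key r, key s, smul_mul_smul_comm, ← Int.negOnePow_add, ← mem_antidiagonal.mp hij,
    Nat.cast_add]

theorem multichoose_succ_right (r : ℝ) (n : ℕ) :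
    multichoose r (n + 1) = multichoose r n * ((r + n) / (n + 1)) := by
  have h1 := factorial_nsmul_multichoose_eq_ascPochhammer r (n + 1)
  have h0 := factorial_nsmul_multichoose_eq_ascPochhammer r n
  rw [Polynomial.ascPochhammer_smeval_eq_eval, nsmul_eq_mul] at h0 h1
  rw [ascPochhammer_succ_right, Polynomial.eval_mul, ← h0, Nat.factorial_succ] at h1
  have hn : (n.factorial : ℝ) ≠ 0 := by positivity
  push_cast at h1
  simp only [Polynomial.eval_add, Polynomial.eval_X, Polynomial.eval_natCast] at h1
  field_simp
  apply mul_left_cancel₀ hn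
  linarith

theorem multichoose_eq_prod (r : ℝ) (n : ℕ) :
    multichoose r n = ∏ j ∈ range n, (r + j) / (j + 1) := by
  induction n with
  | zero => simp
  | succ n ih => rw [multichoose_succ_right, prod_range_succ, ih]

theorem multichoose_nonneg {r : ℝ} (hr : 0 ≤ r) (n : ℕ) : 0 ≤ multichoose r n := by
  rw [multichoose_eq_prod]
  exact prod_nonneg fun j _ => by positivity

theorem multichoose_neg_nonpos {a : ℝ} (h0 : 0 ≤ a) (h1 : a ≤ 1) (n : ℕ) :
    multichoose (-a) (n + 1) ≤ 0 := by
  induction n with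
  | zero => simpa using h0
  | succ n ih =>
    rw [multichoose_succ_right]
    refine mul_nonpos_of_nonpos_of_nonneg ih (div_nonneg ?_ (by positivity))
    push_cast
    linarith [(Nat.cast_nonneg n : (0 : ℝ) ≤ n)]

theorem multichoose_add_one_le_pow {s : ℝ} (hs : 0 ≤ s) (n : ℕ) :
    multichoose (s + 1) n ≤ (s + 1) ^ n := by
  rw [multichoose_eq_prod, ← card_range n, ← prod_const, card_range]
  refine prod_le_prod (fun j _ => by positivity) fun j _ => ?_
  rw [div_le_iff₀ (by positivity)]
  nlinarith [(Nat.cast_nonneg j : (0 : ℝ) ≤ j)]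

theorem multichoose_div_rpow_le_of_le {s : ℝ} (hs : 0 ≤ s) {m n : ℕ} (hm : 1 ≤ m)
    (hmn : m ≤ n) :
    multichoose (s + 1) n / (n : ℝ) ^ s ≤ multichoose (s + 1) m / (m : ℝ) ^ s := by
  induction n, hmn using Nat.le_induction with
  | base => exact le_rfl
  | succ n hn ih =>
    refine le_trans ?_ ih
    have hn0 : (0 : ℝ) < n := by exact_mod_cast (by omega : 0 < n)
    rw [multichoose_succ_right, mul_div_assoc, div_eq_mul_inv (multichoose _ _)]
    refine mul_le_mul_of_nonneg_left ?_ (multichoose_nonneg (by linarith) n)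
    have hlog : s / (n + 1) ≤ s * Real.log ((n + 1) / n) := by
      have := Real.one_sub_inv_le_log_of_pos (x := (n + 1 : ℝ) / n) (by positivity)
      rw [div_eq_mul_one_div]
      refine mul_le_mul_of_nonneg_left (le_trans (le_of_eq ?_) this) hs
      field_simp
      ring
    have hle : (s + 1 + n) / (n + 1) ≤ ((n + 1 : ℝ) / n) ^ s := by
      rw [Real.rpow_def_of_pos (by positivity), mul_comm]
      calc (s + 1 + n) / (n + 1 : ℝ) = s / (n + 1) + 1 := by field_simp; ring
        _ ≤ Real.exp (s / (n + 1)) := Real.add_one_le_exp _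
        _ ≤ _ := Real.exp_le_exp.mpr hlog
    rw [Real.div_rpow (by positivity) hn0.le] at hle
    rw [div_le_iff₀ (by positivity)]
    push_cast
    calc _ ≤ _ := hle
      _ = _ := by ring

theorem tendsto_multichoose_div_rpow {s : ℝ} (hs : 0 ≤ s) :
    Tendsto (fun n : ℕ => multichoose (s + 1) n / (n : ℝ) ^ s) atTop
      (𝓝 (Real.Gamma (s + 1))⁻¹) := by
  have hG : Real.Gamma (s + 1) ≠ 0 := (Real.Gamma_pos_of_pos (by linarith)).ne'
  have h1 := (Real.GammaSeq_tendsto_Gamma (s + 1)).inv₀ hG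
  have h2 : Tendsto (fun n : ℕ => (n : ℝ) / (n + (s + 1))) atTop (𝓝 1) :=
    tendsto_natCast_div_add_atTop (s + 1)
  have h3 := h1.mul h2
  rw [mul_one] at h3
  refine h3.congr' ?_
  filter_upwards [eventually_ge_atTop 1] with n hn
  have hn0 : (0 : ℝ) < n := by exact_mod_cast hn
  have hp : multichoose (s + 1) n = (∏ j ∈ range n, (s + 1 + (j : ℝ))) / (n.factorial : ℝ) := by
    rw [multichoose_eq_prod, prod_div_distrib, ← prod_range_add_one_eq_factorial]
    push_cast
    rfl
  rw [hp, Real.GammaSeq, prod_range_succ, Real.rpow_add_one hn0.ne']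
  have : (0 : ℝ) < s + 1 + n := by positivity
  have : (0 : ℝ) < n + (s + 1) := by positivity
  have : (0 : ℝ) < ∏ j ∈ range n, (s + 1 + (j : ℝ)) := prod_pos fun j _ => by positivity
  field_simp
  ring

theorem summable_pow_mul_multichoose {a r : ℝ} (ha0 : 0 ≤ a) (ha1 : a ≤ 1) (hr : |r| < 1) (n : ℕ) :
    Summable fun k : ℕ => r ^ k * multichoose (a * k + 1) n := by
  rcases eq_or_ne r 0 with rfl | hr0
  · refine summable_of_ne_finset_zero (s := {0}) fun k hk => ?_
    simp [show k ≠ 0 by simpa using hk]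
  have h := summable_pow_mul_geometric_of_norm_lt_one n (r := |r|) (by simpa using hr)
  have h' := ((summable_nat_add_iff 1).mpr h).mul_left |r|⁻¹
  refine Summable.of_norm_bounded h' fun k => ?_
  have hak : 0 ≤ a * k := by positivity
  rw [norm_mul, norm_pow, Real.norm_eq_abs, Real.norm_eq_abs,
    abs_of_nonneg (multichoose_nonneg (by linarith) n)]
  calc |r| ^ k * multichoose (a * k + 1) n ≤ |r| ^ k * ((k + 1 : ℕ) : ℝ) ^ n := by
        gcongr
        refine (multichoose_add_one_le_pow hak n).trans ?_
        push_cast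
        gcongr
        nlinarith [(Nat.cast_nonneg k : (0 : ℝ) ≤ k)]
    _ = |r|⁻¹ * (((k + 1 : ℕ) : ℝ) ^ n * |r| ^ (k + 1)) := by
        have : |r| ≠ 0 := abs_ne_zero.mpr hr0
        rw [pow_succ]
        field_simp

/-- The series is the `n`-th coefficient of `(1 - z) ^ (a - 1) / ((1 - z) ^ a + μ)`. -/
theorem tsum_pow_mul_multichoose_mem_Icc {a μ : ℝ} (ha0 : 0 ≤ a) (ha1 : a ≤ 1) (hμ0 : 0 ≤ μ)
    (hμ1 : μ < 1) (n : ℕ) :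
    ∑' k : ℕ, (-μ) ^ k * multichoose (a * k + 1) n ∈ Set.Icc (0 : ℝ) 1 := by
  set A : ℕ → ℝ := fun n => ∑' k : ℕ, (-μ) ^ k * multichoose (a * k + 1) n with hA
  have hs : ∀ n, Summable fun k : ℕ => (-μ) ^ k * multichoose (a * k + 1) n :=
    summable_pow_mul_multichoose ha0 ha1 (by rwa [abs_neg, abs_of_nonneg hμ0])
  have hconv : ∀ n, ∑ ij ∈ antidiagonal n, multichoose (-a) ij.1 * A ij.2
      = multichoose (1 - a) n - μ * A n := by
    intro n
    have hterm : ∀ k : ℕ, ∑ ij ∈ antidiagonal n,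
        multichoose (-a) ij.1 * ((-μ) ^ k * multichoose (a * k + 1) ij.2)
          = (-μ) ^ k * multichoose (-a + (a * k + 1)) n := by
      intro k
      rw [multichoose_add, mul_sum]
      exact sum_congr rfl fun ij _ => by ring
    have hshift : ∀ k : ℕ, (-μ) ^ (k + 1) * multichoose (-a + (a * (k + 1 : ℕ) + 1)) n
        = -μ * ((-μ) ^ k * multichoose (a * k + 1) n) := by
      intro k
      rw [show -a + (a * (k + 1 : ℕ) + 1) = a * k + 1 by push_cast; ring]
      ring
    have hsum : Summable fun k : ℕ => (-μ) ^ k * multichoose (-a + (a * k + 1)) n := by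
      rw [← summable_nat_add_iff 1]
      simp only [hshift]
      exact (hs n).mul_left _
    have hswap : HasSum (fun k : ℕ => (-μ) ^ k * multichoose (-a + (a * k + 1)) n)
        (∑ ij ∈ antidiagonal n, multichoose (-a) ij.1 * A ij.2) := by
      simp only [← hterm]
      exact hasSum_sum fun ij _ => (hs ij.2).hasSum.mul_left _
    rw [← hswap.tsum_eq, hsum.tsum_eq_zero_add, tsum_congr hshift, tsum_mul_left]
    simp only [pow_zero, Nat.cast_zero, mul_zero, zero_add, one_mul]
    rw [neg_add_eq_sub]
    ring
  have hrec : ∀ n, (1 + μ) * A n = multichoose (1 - a) n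
      + ∑ i ∈ range n, -multichoose (-a) (i + 1) * A (n - (i + 1)) := by
    intro n
    have h := hconv n
    rw [Nat.sum_antidiagonal_eq_sum_range_succ (fun i j => multichoose (-a) i * A j),
      sum_range_succ'] at h
    simp only [multichoose_zero_right, one_mul, Nat.sub_zero] at h
    simp only [neg_mul, sum_neg_distrib]
    linarith
  have hone : ∀ n, multichoose (1 - a) n + ∑ i ∈ range n, -multichoose (-a) (i + 1) = 1 := by
    intro n
    have h := multichoose_add (-a) 1 n
    rw [Nat.sum_antidiagonal_eq_sum_range_succ (fun i j => multichoose (-a) i * multichoose 1 j),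
      sum_range_succ'] at h
    simp only [multichoose_zero_right, multichoose_one, mul_one] at h
    rw [neg_add_eq_sub] at h
    simp only [sum_neg_distrib]
    linarith
  change A n ∈ Set.Icc (0 : ℝ) 1
  induction n using Nat.strong_induction_on with
  | _ n ih =>
    have hmem : ∀ i ∈ range n, A (n - (i + 1)) ∈ Set.Icc (0 : ℝ) 1 := fun i hi =>
      ih _ (by have := mem_range.mp hi; omega)
    have hg : ∀ i, 0 ≤ -multichoose (-a) (i + 1) := fun i =>
      neg_nonneg.mpr (multichoose_neg_nonpos ha0 ha1 i)
    have hlow : 0 ≤ (1 + μ) * A n := by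
      rw [hrec]
      exact add_nonneg (multichoose_nonneg (by linarith) n)
        (sum_nonneg fun i hi => mul_nonneg (hg i) (hmem i hi).1)
    have hup : (1 + μ) * A n ≤ 1 := by
      rw [hrec]
      exact (add_le_add le_rfl (sum_le_sum fun i hi =>
        mul_le_of_le_one_right (hg i) (hmem i hi).2)).trans_eq (hone n)
    have h0 : 0 ≤ A n := nonneg_of_mul_nonneg_right hlow (by linarith)
    exact ⟨h0, by nlinarith⟩

end Ring

open Ring

theorem tendsto_div_natCast_rpow (x : ℝ) {a : ℝ} (ha : 0 < a) :
    Tendsto (fun n : ℕ => x / (n : ℝ) ^ a) atTop (𝓝 0) :=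
  ((tendsto_rpow_atTop ha).comp tendsto_natCast_atTop_atTop).const_div_atTop x

theorem natCast_rpow_mul_natCast (n k : ℕ) (a : ℝ) : (n : ℝ) ^ (a * k) = ((n : ℝ) ^ a) ^ k := by
  rw [Real.rpow_mul (Nat.cast_nonneg n), Real.rpow_natCast]

theorem summable_pow_div_Gamma {a x : ℝ} (ha0 : 0 < a) (ha1 : a ≤ 1) :
    Summable fun k : ℕ => x ^ k / Real.Gamma (a * k + 1) := by
  obtain ⟨J, hJ, hJ1⟩ := (((tendsto_div_natCast_rpow x ha0).abs.eventually_lt_const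
    (by simp : |(0 : ℝ)| < 1)).and (eventually_ge_atTop 1)).exists
  refine Summable.of_norm_bounded (summable_pow_mul_multichoose ha0.le ha1 hJ J).norm
    fun k => ?_
  have hk : 0 ≤ a * k := by positivity
  have hle : (Real.Gamma (a * k + 1))⁻¹ ≤ multichoose (a * k + 1) J / (J : ℝ) ^ (a * k) :=
    le_of_tendsto (tendsto_multichoose_div_rpow hk)
      (eventually_atTop.mpr ⟨J, fun n hn => multichoose_div_rpow_le_of_le hk hJ1 hn⟩)
  have hG := Real.Gamma_pos_of_pos (by linarith : 0 < a * k + 1)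
  rw [div_eq_mul_inv, norm_mul, div_pow, div_mul_eq_mul_div, mul_div_assoc, norm_mul,
    ← natCast_rpow_mul_natCast, Real.norm_of_nonneg (inv_nonneg.mpr hG.le),
    Real.norm_of_nonneg (div_nonneg (multichoose_nonneg (by linarith) J) (by positivity))]
  gcongr

theorem mittagLeffler_neg_mem_Icc {a x : ℝ} (ha0 : 0 < a) (ha1 : a ≤ 1) (hx : 0 ≤ x) :
    mittagLeffler a 1 (-x) ∈ Set.Icc (0 : ℝ) 1 := by
  obtain ⟨J, hJ⟩ := eventually_atTop.mp
    (((tendsto_div_natCast_rpow x ha0).eventually_lt_const one_pos).and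
      (eventually_ge_atTop 1))
  have hJ1 : 1 ≤ J := (hJ J le_rfl).2
  have hterm : ∀ n k : ℕ, (-(x / (n : ℝ) ^ a)) ^ k * multichoose (a * k + 1) n
      = (-x) ^ k * (multichoose (a * k + 1) n / (n : ℝ) ^ (a * k)) := by
    intro n k
    rw [← neg_div, div_pow, natCast_rpow_mul_natCast]
    ring
  have hlim : Tendsto
      (fun n : ℕ => ∑' k : ℕ, (-(x / (n : ℝ) ^ a)) ^ k * multichoose (a * k + 1) n)
      atTop (𝓝 (mittagLeffler a 1 (-x))) := by
    refine tendsto_tsum_of_dominated_convergence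
      (bound := fun k => ‖(-(x / (J : ℝ) ^ a)) ^ k * multichoose (a * k + 1) J‖)
      (summable_pow_mul_multichoose ha0.le ha1 ?_ J).norm (fun k => ?_) ?_
    · rw [abs_neg, abs_of_nonneg (by positivity)]
      exact (hJ J le_rfl).1
    · simp only [hterm]
      rw [div_eq_mul_inv]
      exact (tendsto_multichoose_div_rpow (by positivity)).const_mul _
    · filter_upwards [eventually_ge_atTop J] with n hn k
      have hk : 0 ≤ a * k := by positivity
      rw [hterm, hterm, norm_mul, norm_mul,
        Real.norm_of_nonneg (div_nonneg (multichoose_nonneg (by linarith) n) (by positivity)),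
        Real.norm_of_nonneg (div_nonneg (multichoose_nonneg (by linarith) J) (by positivity))]
      exact mul_le_mul_of_nonneg_left (multichoose_div_rpow_le_of_le hk hJ1 hn) (norm_nonneg _)
  refine isClosed_Icc.mem_of_tendsto hlim ?_
  filter_upwards [eventually_ge_atTop J] with n hn
  exact tsum_pow_mul_multichoose_mem_Icc ha0.le ha1 (by positivity) (hJ n hn).1 n

theorem exists_abs_mittagLeffler_neg_sub_sum_le {a : ℝ} (ha0 : 0 < a) (ha1 : a ≤ 1) (m : ℕ) :
    ∃ C : ℝ, ∀ x : ℝ, 0 ≤ x →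
      |mittagLeffler a 1 (-x) - ∑ k ∈ range m, (-x) ^ k / Real.Gamma (a * k + 1)| ≤ C * x ^ m := by
  have hG : ∀ k : ℕ, 0 < Real.Gamma (a * k + 1) := fun k =>
    Real.Gamma_pos_of_pos (by positivity)
  have hS : Summable fun k : ℕ => (Real.Gamma (a * k + 1))⁻¹ := by
    simpa using summable_pow_div_Gamma (x := 1) ha0 ha1
  have hnorm : ∀ (x : ℝ) (k : ℕ), 0 ≤ x →
      ‖(-x) ^ k / Real.Gamma (a * k + 1)‖ = x ^ k * (Real.Gamma (a * k + 1))⁻¹ := by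
    intro x k hx
    rw [norm_div, norm_pow, norm_neg, Real.norm_of_nonneg hx, Real.norm_of_nonneg (hG k).le,
      div_eq_mul_inv]
  refine ⟨1 + ∑' k : ℕ, (Real.Gamma (a * k + 1))⁻¹, fun x hx => ?_⟩
  rcases le_total x 1 with h1 | h1
  · have hE : Summable fun k : ℕ => (-x) ^ k / Real.Gamma (a * k + 1) :=
      summable_pow_div_Gamma ha0 ha1
    rw [mittagLeffler, ← hE.sum_add_tsum_nat_add m, add_sub_cancel_left, ← Real.norm_eq_abs]
    have hSm := (summable_nat_add_iff m).mpr hS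
    calc _ ≤ ∑' k : ℕ, x ^ m * (Real.Gamma (a * (k + m : ℕ) + 1))⁻¹ := by
          refine tsum_of_norm_bounded (hSm.mul_left _).hasSum fun k => ?_
          rw [hnorm x _ hx]
          refine mul_le_mul_of_nonneg_right ?_ (inv_nonneg.mpr (hG _).le)
          exact pow_le_pow_of_le_one hx h1 (Nat.le_add_left _ _)
      _ = (∑' k : ℕ, (Real.Gamma (a * (k + m : ℕ) + 1))⁻¹) * x ^ m := by
          rw [tsum_mul_left, mul_comm]
      _ ≤ _ := by
          gcongr
          rw [← hS.sum_add_tsum_nat_add m]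
          have := sum_nonneg fun (k : ℕ) (_ : k ∈ range m) => (inv_nonneg.mpr (hG k).le)
          linarith
  · have hE := mittagLeffler_neg_mem_Icc ha0 ha1 hx
    have hxm : 1 ≤ x ^ m := one_le_pow₀ h1
    calc _ ≤ |mittagLeffler a 1 (-x)| + |∑ k ∈ range m, (-x) ^ k / Real.Gamma (a * k + 1)| :=
          abs_sub _ _
      _ ≤ x ^ m + ∑ k ∈ range m, x ^ m * (Real.Gamma (a * k + 1))⁻¹ := by
          refine add_le_add (by rw [abs_of_nonneg hE.1]; exact hE.2.trans hxm) ?_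
          refine (abs_sum_le_sum_abs _ _).trans (sum_le_sum fun k hk => ?_)
          rw [← Real.norm_eq_abs, hnorm x _ hx]
          refine mul_le_mul_of_nonneg_right ?_ (inv_nonneg.mpr (hG _).le)
          exact pow_le_pow_right₀ h1 (mem_range.mp hk).le
      _ ≤ x ^ m + x ^ m * ∑' k : ℕ, (Real.Gamma (a * k + 1))⁻¹ := by
          rw [← mul_sum]
          gcongr
          exact hS.sum_le_tsum _ fun k _ => inv_nonneg.mpr (hG k).le
      _ = _ := by ring


/-- Let `0 < α < 1`, `(λ_n)` positive, `(ψ_n)` real with `∑ λ_n^ℓ |ψ_n| < ∞` for all `ℓ`.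
If there are positive times `t_i → 0` with `∑_n E_{α,1}(-λ_n t_i^α) ψ_n = 0` for each `i`,
then all moments vanish: `∑_n λ_n^ℓ ψ_n = 0` for every `ℓ ∈ ℕ`. -/
theorem moments_vanish_of_vanishing_at_times_tendsto_zero
    (α : ℝ) (hα0 : 0 < α) (hα1 : α < 1)
    (lam ψ : ℕ → ℝ) (hlam : ∀ n, 0 < lam n)
    (hsum : ∀ ℓ : ℕ, Summable (fun n => lam n ^ ℓ * |ψ n|))
    (t : ℕ → ℝ) (ht : ∀ i, 0 < t i)
    (htend : Filter.Tendsto t Filter.atTop (nhds 0))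
    (hvanish : ∀ i, ∑' n, mittagLeffler α 1 (-lam n * t i ^ α) * ψ n = 0) :
    ∀ ℓ : ℕ, ∑' n, lam n ^ ℓ * ψ n = 0 := by
  have hmoment : ∀ ℓ : ℕ, Summable fun n => lam n ^ ℓ * ψ n := fun ℓ =>
    (hsum ℓ).of_norm_bounded fun n => by
      rw [norm_mul, norm_pow, Real.norm_of_nonneg (hlam n).le, Real.norm_eq_abs]
  intro ℓ
  induction ℓ using Nat.strong_induction_on with
  | _ ℓ ih =>
  obtain ⟨C, hC⟩ := exists_abs_mittagLeffler_neg_sub_sum_le hα0 hα1.le (ℓ + 1)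
  have hG : 0 < Real.Gamma (α * ℓ + 1) := Real.Gamma_pos_of_pos (by positivity)
  set M := ∑' n, lam n ^ ℓ * ψ n with hM
  set B := C * ∑' n, lam n ^ (ℓ + 1) * |ψ n| with hB
  have hbound : ∀ i, |M| / Real.Gamma (α * ℓ + 1) ≤ B * t i ^ α := by
    intro i
    set s := t i ^ α with hs
    have hs0 : 0 < s := Real.rpow_pos_of_pos (ht i) α
    set P : ℕ → ℝ := fun n =>
      ∑ k ∈ range (ℓ + 1), (-(lam n * s)) ^ k / Real.Gamma (α * k + 1) with hP
    have hPterm : ∀ n, P n * ψ n = ∑ k ∈ range (ℓ + 1),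
        (-s) ^ k / Real.Gamma (α * k + 1) * (lam n ^ k * ψ n) := by
      intro n
      rw [hP, sum_mul]
      refine sum_congr rfl fun k _ => ?_
      rw [← mul_neg, mul_pow]
      ring
    have hPsum : HasSum (fun n => P n * ψ n) ((-s) ^ ℓ / Real.Gamma (α * ℓ + 1) * M) := by
      have h := hasSum_sum fun (k : ℕ) (_ : k ∈ range (ℓ + 1)) =>
        ((hmoment k).hasSum.mul_left ((-s) ^ k / Real.Gamma (α * k + 1)))
      rw [sum_range_succ, sum_eq_zero fun k hk => by rw [ih k (mem_range.mp hk), mul_zero],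
        zero_add] at h
      simpa only [hPterm] using h
    have hRle : ∀ n, ‖(mittagLeffler α 1 (-lam n * s) - P n) * ψ n‖
        ≤ C * s ^ (ℓ + 1) * (lam n ^ (ℓ + 1) * |ψ n|) := by
      intro n
      have h := hC (lam n * s) (mul_pos (hlam n) hs0).le
      rw [norm_mul, Real.norm_eq_abs, Real.norm_eq_abs, neg_mul]
      calc _ ≤ C * (lam n * s) ^ (ℓ + 1) * |ψ n| := mul_le_mul_of_nonneg_right h (abs_nonneg _)
        _ = C * s ^ (ℓ + 1) * (lam n ^ (ℓ + 1) * |ψ n|) := by rw [mul_pow]; ring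
    have hdom := (hsum (ℓ + 1)).hasSum.mul_left (C * s ^ (ℓ + 1))
    have hRsum : Summable fun n => (mittagLeffler α 1 (-lam n * s) - P n) * ψ n :=
      hdom.summable.of_norm_bounded hRle
    have hzero : ∑' n, (mittagLeffler α 1 (-lam n * s) - P n) * ψ n
        + (-s) ^ ℓ / Real.Gamma (α * ℓ + 1) * M = 0 := by
      rw [← hPsum.tsum_eq, ← hRsum.tsum_add hPsum.summable, ← hvanish i]
      exact tsum_congr fun n => by ring
    have hle := tsum_of_norm_bounded hdom hRle
    rw [eq_neg_of_add_eq_zero_left hzero, norm_neg, norm_mul, norm_div, norm_pow, norm_neg,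
      Real.norm_of_nonneg hs0.le, Real.norm_of_nonneg hG.le, Real.norm_eq_abs] at hle
    refine le_of_mul_le_mul_left ?_ (pow_pos hs0 ℓ)
    calc s ^ ℓ * (|M| / Real.Gamma (α * ℓ + 1)) = s ^ ℓ / Real.Gamma (α * ℓ + 1) * |M| := by ring
      _ ≤ _ := hle
      _ = _ := by rw [hB, pow_succ]; ring
  have hlim : Tendsto (fun i => B * t i ^ α) atTop (𝓝 0) := by
    have h := (htend.rpow_const (p := α) (Or.inr hα0.le)).const_mul B
    rwa [Real.zero_rpow hα0.ne', mul_zero] at h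
  have hle : |M| / Real.Gamma (α * ℓ + 1) ≤ 0 := ge_of_tendsto' hlim hbound
  rw [div_le_iff₀ hG, zero_mul] at hle
  exact abs_nonpos_iff.mp hle
end
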